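/- Let $H$ be a group, $h^*$ a section of $h : H \to H/Z(H)$, $\pi : H/Z(H) \to H/Z(H)$ a group homomorphism, $\sigma_1,\dots,\sigma_n$ automorphisms of $H$, and $s_1,\dots,s_n$ integers; let $\varphi$, $h'^*$, $\mathcal{A}$, $\mathcal{F}$ and $g_{\pi,f}$ be as in the setup. Then every $g \in \mathcal{A}$ equals $g_{\pi,f}$ for some $f \in \mathcal{F}$; indeed, the function $f : H/Z(H) \to Z(H)$ defined by $f(a) := g(h^*(a))\cdot h'^*(a)^{-1}$ takes values in $Z(H)$, belongs to $\mathcal{F}$, and satisfies $g = g_{\pi,f}$. -/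

import Mathlib

/-- `φ(t) = σ₁(t)^{s₁} ⋯ σₙ(t)^{sₙ}` (ordered product). -/
def phi {H : Type*} [Group H] {n : ℕ} (σ : Fin n → H ≃* H) (s : Fin n → ℤ) (t : H) : H :=
  (List.ofFn fun i => (σ i t) ^ (s i)).prod

/-- The "cocycle" `t'(a,b) = h*(a) * h*(b) * h*(ab)⁻¹` of a section `h*`. -/
def cocycle {H : Type*} [Group H] (hs : H ⧸ Subgroup.center H → H)
    (a b : H ⧸ Subgroup.center H) : H :=
  hs a * hs b * (hs (a * b))⁻¹

/-- `g_{π,f}(x) = φ(x * h*(h(x))⁻¹) * f(h(x)) * h'*(h(x))` where `h'* = h* ∘ π`. -/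
def gPi {H : Type*} [Group H] {n : ℕ} (hs : H ⧸ Subgroup.center H → H)
    (π : H ⧸ Subgroup.center H →* H ⧸ Subgroup.center H)
    (σ : Fin n → H ≃* H) (s : Fin n → ℤ)
    (f : H ⧸ Subgroup.center H → H) (x : H) : H :=
  phi σ s (x * (hs (QuotientGroup.mk x))⁻¹) * f (QuotientGroup.mk x) *
    hs (π (QuotientGroup.mk x))

theorem mul_inv_section_mem_center {H : Type*} [Group H]
    (hs : H ⧸ Subgroup.center H → H)
    (hsec : ∀ a : H ⧸ Subgroup.center H,
      (QuotientGroup.mk (hs a) : H ⧸ Subgroup.center H) = a) (x : H) :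
    x * (hs (QuotientGroup.mk x))⁻¹ ∈ Subgroup.center H := by
  rw [← QuotientGroup.eq_one_iff, QuotientGroup.mk_mul, QuotientGroup.mk_inv, hsec,
    mul_inv_cancel]

theorem cocycle_mem_center {H : Type*} [Group H]
    (hs : H ⧸ Subgroup.center H → H)
    (hsec : ∀ a : H ⧸ Subgroup.center H,
      (QuotientGroup.mk (hs a) : H ⧸ Subgroup.center H) = a)
    (a b : H ⧸ Subgroup.center H) : cocycle hs a b ∈ Subgroup.center H := by
  simpa only [cocycle, QuotientGroup.mk_mul, hsec] using
    mul_inv_section_mem_center hs hsec (hs a * hs b)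

theorem mul_inv_mul_mul_inv_of_mem_center {H : Type*} [Group H] {A B C P Q R : H}
    (hB : B * Q⁻¹ ∈ Subgroup.center H) (hC : C * R⁻¹ ∈ Subgroup.center H) :
    A * P⁻¹ * (B * Q⁻¹) = A * B * C⁻¹ * (P * Q * R⁻¹)⁻¹ * (C * R⁻¹) := by
  rw [mul_assoc A, Subgroup.mem_center_iff.mp hB, mul_assoc _ _ (C * R⁻¹),
    Subgroup.mem_center_iff.mp hC]
  group

/-- Every `g ∈ 𝒜` equals `g_{π,f}` for some `f ∈ ℱ`: the function
`f(a) := g(h*(a)) * h'*(a)⁻¹` takes values in `Z(H)`, belongs to `ℱ`, and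
satisfies `g = g_{π,f}`. -/
theorem mem_A_eq_gPi {H : Type*} [Group H] {n : ℕ}
    (hs : H ⧸ Subgroup.center H → H)
    (hsec : ∀ a : H ⧸ Subgroup.center H,
      (QuotientGroup.mk (hs a) : H ⧸ Subgroup.center H) = a)
    (π : H ⧸ Subgroup.center H →* H ⧸ Subgroup.center H)
    (σ : Fin n → H ≃* H) (s : Fin n → ℤ)
    (g : H →* H)
    (hgA1 : ∀ t ∈ Subgroup.center H, g t = phi σ s t)
    (hgA2 : ∀ x : H, g x * (hs (π (QuotientGroup.mk x)))⁻¹ ∈ Subgroup.center H) :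
    (∀ a : H ⧸ Subgroup.center H, g (hs a) * (hs (π a))⁻¹ ∈ Subgroup.center H) ∧
    (∀ a b : H ⧸ Subgroup.center H,
      (g (hs a) * (hs (π a))⁻¹) * (g (hs b) * (hs (π b))⁻¹) =
        phi σ s (cocycle hs a b) * (cocycle (fun c => hs (π c)) a b)⁻¹ *
          (g (hs (a * b)) * (hs (π (a * b)))⁻¹)) ∧
    (∀ x : H, g x = gPi hs π σ s (fun a => g (hs a) * (hs (π a))⁻¹) x) := by
  have hf : ∀ a, g (hs a) * (hs (π a))⁻¹ ∈ Subgroup.center H := fun a => by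
    simpa only [hsec] using hgA2 (hs a)
  refine ⟨hf, fun a b => ?_, fun x => ?_⟩
  · rw [← hgA1 _ (cocycle_mem_center hs hsec a b)]
    simp only [cocycle, map_mul, map_inv]
    simpa only [map_mul] using mul_inv_mul_mul_inv_of_mem_center (hf b) (hf (a * b))
  · rw [gPi, ← hgA1 _ (mul_inv_section_mem_center hs hsec x)]
    simp [mul_assoc]
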